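/- arXiv:2110.09555 — 2 statements merged into one kernel-verified Lean document; each statement's English description precedes it below -/
import Mathlib

section
/- Let d ≥ 1, q ∈ [1, ∞), β ∈ (0, d+2], α > 0 with α > 1 − qβ/(d+2). Then there exists a constant N = N(d, q, α, β) such that for every measurable g ≥ 0 on ℝ^{d+1} and every r ∈ (0, ∞) one has ∫_{ℝ^{d+1}} g^q (M̂ 1_{D_r})^α dz ≤ N r^{d+2−qβ} ‖g‖_{E_{q,β}}^q, where D_r = {(t,x) : |t| ≤ r², |x| ≤ r}. -/
open MeasureTheory Set ENNReal Filter

noncomputable section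

/-- Euclidean space `ℝ^d`. -/
abbrev Ed (d : ℕ) := EuclideanSpace ℝ (Fin d)

/-- Points of `ℝ^{d+1}`: `z = (t, x)`. -/
abbrev Pt (d : ℕ) := ℝ × Ed d

/-- The parabolic cylinder `C_ρ(t,x)`. -/
def pCyl (d : ℕ) (ρ : ℝ) (z : Pt d) : Set (Pt d) :=
  {w | dist z.2 w.2 < ρ ∧ z.1 ≤ w.1 ∧ w.1 < z.1 + ρ ^ 2}

/-- The average `⨍_{C_ρ(z)} f`. -/
def pAvg (d : ℕ) (ρ : ℝ) (z : Pt d) (f : Pt d → ℝ≥0∞) : ℝ≥0∞ :=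
  (volume (pCyl d ρ z))⁻¹ * ∫⁻ w in pCyl d ρ z, f w

/-- The fractional maximal function `M_β f`. -/
def Mbeta (d : ℕ) (β : ℝ) (f : Pt d → ℝ≥0∞) (z : Pt d) : ℝ≥0∞ :=
  ⨆ (ρ : ℝ) (_ : 0 < ρ), ENNReal.ofReal (ρ ^ β) * pAvg d ρ z f

/-- The kernel `p_α(s, r)`. -/
def pKer (d : ℕ) (α : ℝ) (s r : ℝ) : ℝ≥0∞ :=
  if 0 < s then ENNReal.ofReal (s ^ (-(((d : ℝ) + 2 - α) / 2)) * Real.exp (-(r ^ 2) / s)) else 0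

/-- The parabolic potential `P_α f`. -/
def Palpha (d : ℕ) (α : ℝ) (f : Pt d → ℝ≥0∞) (z : Pt d) : ℝ≥0∞ :=
  ∫⁻ w : Pt d, pKer d α w.1 ‖w.2‖ * f (z.1 + w.1, z.2 + w.2)

/-- The parabolic Morrey norm `‖f‖_{E_{p,β}(Q)}`. -/
def MorreyNorm (d : ℕ) (p β : ℝ) (Q : Set (Pt d)) (f : Pt d → ℝ≥0∞) : ℝ≥0∞ :=
  ⨆ (ρ : ℝ) (_ : 0 < ρ) (z : Pt d) (_ : z ∈ Q),
    ENNReal.ofReal (ρ ^ β) * (pAvg d ρ z fun w => Q.indicator f w ^ p) ^ (1 / p)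

/-- The `L_p`-norm on `ℝ^{d+1}`. -/
def LpNormE (d : ℕ) (p : ℝ) (f : Pt d → ℝ≥0∞) : ℝ≥0∞ :=
  (∫⁻ z : Pt d, f z ^ p) ^ (1 / p)

/-- The mixed norm `‖f‖_{L_{q₁,q₂}}`. -/
def MixedNorm (d : ℕ) (q₁ q₂ : ℝ) (f : Pt d → ℝ≥0∞) : ℝ≥0∞ :=
  (∫⁻ t : ℝ, (∫⁻ x : Ed d, f (t, x) ^ q₁) ^ (q₂ / q₁)) ^ (1 / q₂)

/-- The normalized mixed norm `‖f‖_{L_{q₁,q₂}(Γ)}`. -/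
def MixedNormOn (d : ℕ) (q₁ q₂ : ℝ) (Γ : Set (Pt d)) (f : Pt d → ℝ≥0∞) : ℝ≥0∞ :=
  (MixedNorm d q₁ q₂ (Γ.indicator 1))⁻¹ * MixedNorm d q₁ q₂ (Γ.indicator f)

/-- The mixed-norm parabolic Morrey norm `‖f‖_{E_{q₁,q₂,β}(Q)}`. -/
def MixedMorrey (d : ℕ) (q₁ q₂ β : ℝ) (Q : Set (Pt d)) (f : Pt d → ℝ≥0∞) : ℝ≥0∞ :=
  ⨆ (ρ : ℝ) (_ : 0 < ρ) (z : Pt d) (_ : z ∈ Q),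
    ENNReal.ofReal (ρ ^ β) * MixedNormOn d q₁ q₂ (pCyl d ρ z) (Q.indicator f)

/-- The symmetric parabolic maximal function `M̂ f`. -/
def pMax (d : ℕ) (f : Pt d → ℝ≥0∞) (z : Pt d) : ℝ≥0∞ :=
  ⨆ (r : ℝ) (_ : 0 < r) (w : Pt d) (_ : z ∈ pCyl d r w), pAvg d r w f

/-- The time derivative `∂_t u`. -/
def timeDeriv (d : ℕ) (u : Pt d → ℝ) (z : Pt d) : ℝ :=
  fderiv ℝ u z ((1 : ℝ), (0 : Ed d))

/-- The spatial partial derivative `D_i u`. -/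
def spDeriv (d : ℕ) (i : Fin d) (u : Pt d → ℝ) (z : Pt d) : ℝ :=
  fderiv ℝ u z ((0 : ℝ), EuclideanSpace.single i (1 : ℝ))

/-- The Euclidean norm of the spatial gradient `|Du|`. -/
def gradNorm (d : ℕ) (u : Pt d → ℝ) (z : Pt d) : ℝ :=
  Real.sqrt (∑ i : Fin d, spDeriv d i u z ^ 2)

/-- The spatial Laplacian `Δu`. -/
def lap (d : ℕ) (u : Pt d → ℝ) (z : Pt d) : ℝ :=
  ∑ i : Fin d, spDeriv d i (spDeriv d i u) z

/-- The (Frobenius) norm of the spatial Hessian `|D²u|`. -/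
def hessNorm (d : ℕ) (u : Pt d → ℝ) (z : Pt d) : ℝ :=
  Real.sqrt (∑ i : Fin d, ∑ j : Fin d, spDeriv d i (spDeriv d j u) z ^ 2)


lemma pCyl_eq_prod (d : ℕ) (ρ : ℝ) (z : Pt d) :
    pCyl d ρ z = Ico z.1 (z.1 + ρ ^ 2) ×ˢ Metric.ball z.2 ρ := by
  ext w
  simp only [pCyl, mem_ofPred_eq, mem_prod, mem_Ico, Metric.mem_ball, dist_comm w.2 z.2]
  tauto

lemma measurableSet_pCyl (d : ℕ) (ρ : ℝ) (z : Pt d) : MeasurableSet (pCyl d ρ z) := by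
  rw [pCyl_eq_prod]
  exact measurableSet_Ico.prod measurableSet_ball

/-- Volume of the unit ball. -/
def ballVol (d : ℕ) : ℝ := (volume (Metric.ball (0 : Ed d) 1)).toReal

lemma ballVol_pos (d : ℕ) : 0 < ballVol d :=
  ENNReal.toReal_pos (Metric.measure_ball_pos volume _ one_pos).ne' measure_ball_lt_top.ne

lemma volume_pCyl (d : ℕ) {ρ : ℝ} (hρ : 0 < ρ) (z : Pt d) :
    volume (pCyl d ρ z) = ENNReal.ofReal (ballVol d * ρ ^ ((d : ℝ) + 2)) := by
  rw [pCyl_eq_prod, Measure.volume_eq_prod, Measure.prod_prod, Real.volume_Ico,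
    Measure.addHaar_ball_of_pos volume z.2 hρ]
  have h : volume (Metric.ball (0 : Ed d) 1) = ENNReal.ofReal (ballVol d) :=
    (ENNReal.ofReal_toReal measure_ball_lt_top.ne).symm
  have h2 : ρ ^ ((d : ℝ) + 2) = ρ ^ d * ρ ^ 2 := by
    rw [Real.rpow_add hρ, Real.rpow_natCast]; norm_num
  rw [h, h2, ← ENNReal.ofReal_mul (by positivity), add_sub_cancel_left,
    ← ENNReal.ofReal_mul (by positivity)]
  congr 1
  simp
  ring

lemma pAvg_ind_le_one (d : ℕ) (ρ : ℝ) (w : Pt d) (D : Set (Pt d)) :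
    pAvg d ρ w (D.indicator 1) ≤ 1 := by
  unfold pAvg
  calc _ ≤ (volume (pCyl d ρ w))⁻¹ * ∫⁻ _ in pCyl d ρ w, 1 := by
        gcongr with x
        exact indicator_le_self' (by simp) x
    _ ≤ 1 := by
        simp only [lintegral_const, Measure.restrict_apply MeasurableSet.univ, univ_inter, one_mul]
        exact ENNReal.inv_mul_le_one _

/-- The set `D_r`. -/
abbrev Dset (d : ℕ) (r : ℝ) : Set (Pt d) := {w : Pt d | |w.1| ≤ r ^ 2 ∧ ‖w.2‖ ≤ r}

lemma volume_Dset_le (d : ℕ) {r : ℝ} (hr : 0 < r) :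
    volume (Dset d r) ≤ ENNReal.ofReal (ballVol d * (2 * r) ^ ((d : ℝ) + 2)) := by
  rw [← volume_pCyl d (by positivity : 0 < 2 * r) (-(2 * r ^ 2), 0)]
  apply measure_mono
  rintro w ⟨h1, h2⟩
  have := abs_le.1 h1
  have hp : 0 < r ^ 2 := by positivity
  refine ⟨?_, ?_, ?_⟩
  · simp; linarith
  · simp; linarith
  · simp; nlinarith

lemma measurableSet_Dset (d : ℕ) (r : ℝ) : MeasurableSet (Dset d r) := by
  have h1 : MeasurableSet {w : Pt d | |w.1| ≤ r ^ 2} :=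
    (isClosed_le (by fun_prop) (by fun_prop)).measurableSet
  have h2 : MeasurableSet {w : Pt d | ‖w.2‖ ≤ r} :=
    (isClosed_le (by fun_prop) (by fun_prop)).measurableSet
  exact h1.inter h2

/-- Symmetric cylinder. -/
abbrev Acyl (d : ℕ) (R : ℝ) : Set (Pt d) := pCyl d R (-(R ^ 2 / 2), 0)

lemma pMax_le_one (d : ℕ) (D : Set (Pt d)) (z : Pt d) : pMax d (D.indicator 1) z ≤ 1 := by
  unfold pMax
  exact iSup₂_le fun ρ _ => iSup₂_le fun w _ => pAvg_ind_le_one d ρ w D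

lemma pMax_decay (d : ℕ) {r R : ℝ} (hr : 0 < r) (hR : 2 * r ≤ R) (z : Pt d)
    (hz : z ∉ Acyl d R) :
    pMax d ((Dset d r).indicator 1) z ≤ ENNReal.ofReal ((8 * r / R) ^ ((d : ℝ) + 2)) := by
  unfold pMax
  refine iSup₂_le fun ρ hρ => iSup₂_le fun w hw => ?_
  have hR0 : 0 < R := by linarith
  by_cases hne : (pCyl d ρ w ∩ Dset d r).Nonempty
  · obtain ⟨y, hy1, hy2⟩ := hne
    have hρR : R / 4 ≤ ρ := by
      by_contra! hlt
      apply hz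
      obtain ⟨a1, a2, a3⟩ := hw
      obtain ⟨b1, b2, b3⟩ := hy1
      obtain ⟨c1, c2⟩ := hy2
      have c3 := abs_le.1 c1
      have e1 : ρ ^ 2 < (R / 4) ^ 2 := by gcongr
      have e2 : r ^ 2 ≤ (R / 2) ^ 2 := by gcongr; linarith
      have e3 : 0 < R ^ 2 := by positivity
      refine ⟨?_, ?_, ?_⟩
      · have t1 := dist_triangle (0 : Ed d) y.2 z.2
        have t2 := dist_triangle_left y.2 z.2 w.2
        rw [dist_zero_left y.2] at t1
        show dist (0 : Ed d) z.2 < R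
        linarith
      · show -(R ^ 2 / 2) ≤ z.1
        nlinarith
      · show z.1 < -(R ^ 2 / 2) + R ^ 2
        nlinarith
    have hB := ballVol_pos d
    unfold pAvg
    calc _ ≤ (volume (pCyl d ρ w))⁻¹ * volume (Dset d r) := by
          gcongr
          refine (setLIntegral_le_lintegral _ _).trans ?_
          rw [lintegral_indicator_one (measurableSet_Dset d r)]
      _ ≤ (ENNReal.ofReal (ballVol d * (R / 4) ^ ((d : ℝ) + 2)))⁻¹ *
          ENNReal.ofReal (ballVol d * (2 * r) ^ ((d : ℝ) + 2)) := by
          rw [volume_pCyl d hρ]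
          gcongr
          exact volume_Dset_le d hr
      _ = ENNReal.ofReal ((8 * r / R) ^ ((d : ℝ) + 2)) := by
          have hp : 0 < ballVol d * (R / 4) ^ ((d : ℝ) + 2) := by positivity
          rw [← ENNReal.ofReal_inv_of_pos hp, ← ENNReal.ofReal_mul (by positivity)]
          congr 1
          have : 8 * r / R = (2 * r) / (R / 4) := by field_simp; norm_num
          rw [this, Real.div_rpow (x := 2 * r) (y := R / 4) (by positivity) (by positivity)]
          generalize (R / 4) ^ ((d : ℝ) + 2) = a at hp
          have ha : a ≠ 0 := by rintro rfl; simp at hp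
          field_simp
  · have : pAvg d ρ w ((Dset d r).indicator 1) = 0 := by
      unfold pAvg
      rw [setLIntegral_indicator (measurableSet_Dset d r), inter_comm,
        not_nonempty_iff_eq_empty.1 hne]
      simp
    rw [this]; exact zero_le

lemma lintegral_Acyl_le (d : ℕ) {q β : ℝ} (hq : 1 ≤ q) (g : Pt d → ℝ≥0∞) {R : ℝ} (hR : 0 < R)
    (z : Pt d) :
    ∫⁻ w in pCyl d R z, g w ^ q ≤
      ENNReal.ofReal (ballVol d * R ^ ((d : ℝ) + 2 - q * β)) * MorreyNorm d q β univ g ^ q := by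
  have hB := ballVol_pos d
  have hq0 : 0 < q := by linarith
  have hM : ENNReal.ofReal (R ^ β) * (pAvg d R z fun w => g w ^ q) ^ (1 / q) ≤
      MorreyNorm d q β univ g := by
    unfold MorreyNorm
    simp only [indicator_univ]
    exact le_iSup₂_of_le R hR (le_iSup₂_of_le z (mem_univ z) le_rfl)
  have hM2 := ENNReal.rpow_le_rpow hM hq0.le
  rw [ENNReal.mul_rpow_of_nonneg _ _ hq0.le, ← ENNReal.rpow_mul,
    one_div_mul_cancel hq0.ne', ENNReal.rpow_one,
    ENNReal.ofReal_rpow_of_nonneg (by positivity) hq0.le, ← Real.rpow_mul hR.le] at hM2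
  have hv := volume_pCyl d hR z
  have hI : ∫⁻ w in pCyl d R z, g w ^ q = volume (pCyl d R z) * pAvg d R z fun w => g w ^ q := by
    unfold pAvg
    rw [← mul_assoc, ENNReal.mul_inv_cancel, one_mul]
    · rw [hv]; simp; positivity
    · rw [hv]; simp
  rw [hI, hv]
  calc _ = ENNReal.ofReal (ballVol d * R ^ ((d : ℝ) + 2 - q * β)) *
        (ENNReal.ofReal (R ^ (β * q)) * pAvg d R z fun w => g w ^ q) := by
        rw [← mul_assoc, ← ENNReal.ofReal_mul (by positivity), mul_assoc (ballVol d),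
          ← Real.rpow_add hR]
        ring_nf
    _ ≤ _ := by gcongr

lemma exists_mem_Acyl (d : ℕ) {r : ℝ} (hr : 0 < r) (z : Pt d) :
    ∃ k : ℕ, z ∈ Acyl d (2 * r * 2 ^ k) := by
  have ht : Tendsto (fun k : ℕ => 2 * r * (2 : ℝ) ^ k) atTop atTop :=
    (tendsto_pow_atTop_atTop_of_one_lt (one_lt_two (α := ℝ))).const_mul_atTop (by positivity)
  obtain ⟨k, hk1⟩ := (ht.eventually_gt_atTop (‖z.2‖ + 2 * |z.1| + 1)).exists
  refine ⟨k, ?_⟩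
  generalize 2 * r * (2 : ℝ) ^ k = R at hk1
  have h1 := norm_nonneg z.2
  have h2 := abs_nonneg z.1
  have h3 := neg_abs_le z.1
  have h4 := le_abs_self z.1
  have h5 : R ≤ R ^ 2 := by nlinarith
  refine ⟨?_, ?_, ?_⟩
  · simp; linarith
  · simp; linarith
  · simp; linarith

lemma pMax_pow_le (d : ℕ) {α r : ℝ} (hα : 0 < α) (hr : 0 < r) (z : Pt d) :
    pMax d ((Dset d r).indicator 1) z ^ α ≤ ∑' k : ℕ, (Acyl d (2 * r * 2 ^ k)).indicator
      (fun _ => ENNReal.ofReal ((8 / 2 ^ k) ^ (((d : ℝ) + 2) * α))) z := by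
  classical
  have hex := exists_mem_Acyl d hr z
  refine le_trans ?_ (ENNReal.le_tsum (Nat.find hex))
  rw [indicator_of_mem (Nat.find_spec hex)]
  rcases hk : Nat.find hex with _ | k
  · calc _ ≤ (1 : ℝ≥0∞) ^ α := by gcongr; exact pMax_le_one _ _ _
      _ = ENNReal.ofReal 1 := by simp
      _ ≤ _ := by
        gcongr
        apply Real.one_le_rpow (by norm_num) (by positivity)
  · have hz : z ∉ Acyl d (2 * r * 2 ^ k) := Nat.find_min hex (by omega)
    have h2 : (1 : ℝ) ≤ 2 ^ k := one_le_pow₀ one_le_two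
    calc _ ≤ (ENNReal.ofReal ((8 * r / (2 * r * 2 ^ k)) ^ ((d : ℝ) + 2))) ^ α := by
          gcongr
          exact pMax_decay d hr (by nlinarith) z hz
      _ = _ := by
          rw [ENNReal.ofReal_rpow_of_nonneg (by positivity) hα.le, ← Real.rpow_mul (by positivity)]
          congr 2
          rw [pow_succ]
          field_simp

/-- (Lemma 4.2 b)): for `q ∈ [1,∞)`, `β ∈ (0,d+2]`, `α > 0` with
`α > 1 − qβ/(d+2)`, one has `∫ g^q (M̂ 1_{D_r})^α dz ≤ N r^{d+2−qβ} ‖g‖_{E_{q,β}}^q`,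
where `D_r = {|t| ≤ r², |x| ≤ r}`. -/
theorem stmt14 (d : ℕ) (hd : 1 ≤ d) (q β α : ℝ) (hq : 1 ≤ q) (hβ : 0 < β)
    (hβ' : β ≤ (d : ℝ) + 2) (hα : 0 < α) (hα' : 1 - q * β / ((d : ℝ) + 2) < α) :
    ∃ N : ℝ, 0 < N ∧ ∀ g : Pt d → ℝ≥0∞, Measurable g → ∀ r : ℝ, 0 < r →
      ∫⁻ z : Pt d, g z ^ q *
          pMax d ({w : Pt d | |w.1| ≤ r ^ 2 ∧ ‖w.2‖ ≤ r}.indicator 1) z ^ α ≤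
        ENNReal.ofReal (N * r ^ ((d : ℝ) + 2 - q * β)) *
          MorreyNorm d q β univ g ^ q := by
  have hB := ballVol_pos d
  set n : ℝ := (d : ℝ) + 2 with hn
  have hn0 : 0 < n := by positivity
  have hx : n - q * β - n * α < 0 := by
    have h1 : (1 - q * β / n) * n < α * n := by gcongr
    have h2 : (1 - q * β / n) * n = n - q * β := by field_simp
    linarith
  set x : ℝ := (2 : ℝ) ^ (n - q * β - n * α) with hxdef
  have hx0 : 0 < x := by positivity
  have hx1 : x < 1 := Real.rpow_lt_one_of_one_lt_of_neg one_lt_two hx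
  have hx2 : 0 < 1 - x := by linarith
  refine ⟨8 ^ (n * α) * ballVol d * 2 ^ (n - q * β) * (1 - x)⁻¹, by positivity, ?_⟩
  intro g hg r hr
  have hgq : Measurable fun z => g z ^ q := hg.pow_const q
  calc _ ≤ ∫⁻ z : Pt d, ∑' k : ℕ, (Acyl d (2 * r * 2 ^ k)).indicator
          (fun z => ENNReal.ofReal ((8 / 2 ^ k) ^ (n * α)) * g z ^ q) z := by
        refine lintegral_mono fun z => ?_
        refine (mul_le_mul_right (pMax_pow_le d hα hr z) _).trans ?_
        rw [← ENNReal.tsum_mul_left]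
        refine ENNReal.tsum_le_tsum fun k => ?_
        by_cases hz : z ∈ Acyl d (2 * r * 2 ^ k)
        · rw [indicator_of_mem hz, indicator_of_mem hz, mul_comm]
        · rw [indicator_of_notMem hz, indicator_of_notMem hz, mul_zero]
    _ = ∑' k : ℕ, ENNReal.ofReal ((8 / 2 ^ k) ^ (n * α)) *
          ∫⁻ z in Acyl d (2 * r * 2 ^ k), g z ^ q := by
        rw [lintegral_tsum]
        · congr 1
          ext k
          rw [lintegral_indicator (measurableSet_pCyl _ _ _), lintegral_const_mul _ hgq]
        · intro k
          exact ((hgq.const_mul _).indicator (measurableSet_pCyl _ _ _)).aemeasurable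
    _ ≤ ∑' k : ℕ, ENNReal.ofReal ((8 ^ (n * α) * ballVol d * 2 ^ (n - q * β) *
          r ^ (n - q * β)) * x ^ k) * MorreyNorm d q β univ g ^ q := by
        refine ENNReal.tsum_le_tsum fun k => ?_
        have hR : 0 < 2 * r * 2 ^ k := by positivity
        refine (mul_le_mul_right (lintegral_Acyl_le d (β := β) hq g hR _) _).trans (le_of_eq ?_)
        rw [← mul_assoc, ← ENNReal.ofReal_mul (by positivity)]
        congr 2
        rw [Real.div_rpow (by positivity) (by positivity), Real.mul_rpow (by positivity)
          (by positivity), Real.mul_rpow (by positivity) (by positivity), hxdef,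
          ← Real.rpow_natCast 2 k, ← Real.rpow_natCast _ k, ← Real.rpow_mul two_pos.le,
          ← Real.rpow_mul two_pos.le, ← Real.rpow_mul two_pos.le]
        have e : (2 : ℝ) ^ ((n - q * β - n * α) * k) =
            2 ^ ((k : ℝ) * (n - q * β)) / 2 ^ ((k : ℝ) * (n * α)) := by
          rw [← Real.rpow_sub two_pos]; ring_nf
        rw [e]
        ring
    _ = _ := by
        rw [ENNReal.tsum_mul_right, ← ENNReal.ofReal_tsum_of_nonneg (fun k => by positivity)
          ((summable_geometric_of_lt_one hx0.le hx1).mul_left _), tsum_mul_left,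
          tsum_geometric_of_lt_one hx0.le hx1]
        congr 2
        ring
end
end

section
/- Let d ≥ 1 and p, q ∈ (1, ∞). Then there exists a constant N = N(d, p, q) such that for every measurable f ≥ 0 on ℝ^{d+1} one has ∫_ℝ (∫_{ℝ^d} (M̂ f)^p dx)^{q/p} dt ≤ N ∫_ℝ (∫_{ℝ^d} f^p dx)^{q/p} dt. -/
open MeasureTheory Set ENNReal Filter

noncomputable section

set_option linter.unusedSectionVars false
set_option linter.style.longLine false

section HL

variable {E : Type*} [NormedAddCommGroup E] [NormedSpace ℝ E] [FiniteDimensional ℝ E]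
  [Nontrivial E] [MeasureSpace E] [BorelSpace E] [(volume : Measure E).IsAddHaarMeasure]

/-- countable family of balls -/
def hlB (E : Type*) [NormedAddCommGroup E] [NormedSpace ℝ E] [FiniteDimensional ℝ E]
    (i : ℕ × ℚ) : Set E :=
  Metric.ball (TopologicalSpace.denseSeq E i.1) (i.2 : ℝ)

/-- average over a ball of the family -/
def hlA (g : E → ℝ≥0∞) (i : ℕ × ℚ) : ℝ≥0∞ :=
  (volume (hlB E i))⁻¹ * ∫⁻ y in hlB E i, g y

/-- countable Hardy-Littlewood maximal function -/
def hlM (g : E → ℝ≥0∞) (x : E) : ℝ≥0∞ :=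
  ⨆ i : ℕ × ℚ, (hlB E i).indicator (fun _ => hlA g i) x

theorem hlB_meas (i : ℕ × ℚ) : MeasurableSet (hlB E i) := Metric.isOpen_ball.measurableSet

theorem hlM_meas (g : E → ℝ≥0∞) : Measurable (hlM g) := by
  unfold hlM
  exact Measurable.iSup fun i => measurable_const.indicator (hlB_meas i)

theorem hlM_meas_param {X : Type*} [MeasurableSpace X] (g : E × X → ℝ≥0∞)
    (hg : Measurable g) : Measurable (fun z : E × X => hlM (fun s => g (s, z.2)) z.1) := by
  unfold hlM
  refine Measurable.iSup fun i => ?_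
  have h1 : Measurable (fun x : X => hlA (fun s => g (s, x)) i) := by
    unfold hlA
    exact (Measurable.lintegral_prod_left' (f := g) (μ := volume.restrict (hlB E i)) hg).const_mul _
  have : (fun z : E × X => (hlB E i).indicator (fun _ => hlA (fun s => g (s, z.2)) i) z.1)
      = (Prod.fst ⁻¹' (hlB E i)).indicator (fun z : E × X => hlA (fun s => g (s, z.2)) i) := by
    ext z
    by_cases h : z.1 ∈ hlB E i
    · rw [indicator_of_mem h, indicator_of_mem (show z ∈ Prod.fst ⁻¹' (hlB E i) from h)]
    · rw [indicator_of_notMem h, indicator_of_notMem (show z ∉ Prod.fst ⁻¹' (hlB E i) from h)]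
  rw [this]
  exact (h1.comp measurable_snd).indicator (measurable_fst (hlB_meas i))

theorem hlA_le_hlM (g : E → ℝ≥0∞) (i : ℕ × ℚ) {x : E} (hx : x ∈ hlB E i) : hlA g i ≤ hlM g x := by
  unfold hlM
  refine le_trans ?_ (le_iSup _ i)
  simp [hx]

theorem hlM_le {g : E → ℝ≥0∞} {x : E} {c : ℝ≥0∞} (h : ∀ i, x ∈ hlB E i → hlA g i ≤ c) :
    hlM g x ≤ c := by
  unfold hlM
  refine iSup_le fun i => ?_
  by_cases hx : x ∈ hlB E i
  · simpa [hx] using h i hx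
  · simp [hx]

theorem hlB_pos {i : ℕ × ℚ} {x : E} (hx : x ∈ hlB E i) :
    volume (hlB E i) ≠ 0 ∧ volume (hlB E i) ≠ ∞ :=
  ⟨(Metric.isOpen_ball.measure_pos _ ⟨x, hx⟩).ne', Metric.isBounded_ball.measure_lt_top.ne⟩

/-- `∫_B g ≤ |B| Mg(x)` -/
theorem hl_lint_le (g : E → ℝ≥0∞) (i : ℕ × ℚ) {x : E} (hx : x ∈ hlB E i) :
    ∫⁻ y in hlB E i, g y ≤ volume (hlB E i) * hlM g x := by
  have h := hlA_le_hlM g i hx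
  obtain ⟨h0, h1⟩ := hlB_pos hx
  calc ∫⁻ y in hlB E i, g y = volume (hlB E i) * hlA g i := by
        unfold hlA; rw [← mul_assoc, ENNReal.mul_inv_cancel h0 h1, one_mul]
    _ ≤ _ := by gcongr

theorem hlM_const_le (c : ℝ≥0∞) (x : E) : hlM (fun _ : E => c) x ≤ c := by
  refine hlM_le fun i hx => ?_
  obtain ⟨h0, h1⟩ := hlB_pos hx
  unfold hlA
  simp [mul_comm c, ← mul_assoc, ENNReal.inv_mul_cancel h0 h1]

theorem hlM_mono {g h : E → ℝ≥0∞} (H : g ≤ᵐ[volume] h) (x : E) : hlM g x ≤ hlM h x := by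
  refine hlM_le fun i hx => le_trans ?_ (hlA_le_hlM h i hx)
  unfold hlA
  gcongr 1
  exact lintegral_mono_ae (ae_restrict_of_ae H)

theorem hlM_add_le {g h : E → ℝ≥0∞} (hg : Measurable g) (x : E) :
    hlM (fun y => g y + h y) x ≤ hlM g x + hlM h x := by
  refine hlM_le fun i hx => le_trans ?_ (add_le_add (hlA_le_hlM g i hx) (hlA_le_hlM h i hx))
  unfold hlA
  rw [lintegral_add_left hg, mul_add]

theorem hlM_tsum_le {g : ℕ → E → ℝ≥0∞} (hg : ∀ k, Measurable (g k)) (x : E) :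
    hlM (fun y => ∑' k, g k y) x ≤ ∑' k, hlM (g k) x := by
  refine hlM_le fun i hx => le_trans ?_ (ENNReal.tsum_le_tsum fun k => hlA_le_hlM (g k) i hx)
  unfold hlA
  rw [lintegral_tsum fun k => (hg k).aemeasurable, ENNReal.tsum_mul_left]

theorem hlM_const_mul_le {g : E → ℝ≥0∞} (hg : Measurable g) (c : ℝ≥0∞) (x : E) :
    hlM (fun y => c * g y) x ≤ c * hlM g x := by
  refine hlM_le fun i hx => le_trans ?_ (mul_le_mul_right (hlA_le_hlM g i hx) c)
  unfold hlA
  rw [lintegral_const_mul c hg, mul_left_comm]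

/-- the constant in the weak-type estimate -/
def hlC (E : Type*) [NormedAddCommGroup E] [NormedSpace ℝ E] : ℝ≥0∞ :=
  ENNReal.ofReal (6 ^ Module.finrank ℝ E)

theorem hl_weak_fin {g φ : E → ℝ≥0∞} (l : ℝ≥0∞)
    (F : Finset (ℕ × ℚ)) (hF : ∀ i ∈ F, l < hlA g i) :
    l * ∫⁻ x in ⋃ i ∈ F, hlB E i, φ x ≤ hlC E * ∫⁻ x, g x * hlM φ x := by
  classical
  obtain ⟨R, hR⟩ : ∃ R : ℝ, ∀ i ∈ (F : Set (ℕ × ℚ)), (i.2 : ℝ) ≤ R := by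
    obtain ⟨R, hR⟩ := (F.image fun i => (i.2 : ℝ)).bddAbove
    exact ⟨R, fun i hi => hR (by simpa using ⟨_, hi⟩)⟩
  obtain ⟨u, huF, hdisj, hcov⟩ := Vitali.exists_disjoint_subfamily_covering_enlargement_closedBall
    (F : Set (ℕ × ℚ)) (fun i => TopologicalSpace.denseSeq E i.1) (fun i => (i.2 : ℝ)) R hR 5
    (by norm_num)
  have hufin : u.Finite := F.finite_toSet.subset huF
  have hcov' : (⋃ i ∈ F, hlB E i) ⊆ ⋃ j ∈ u, hlB E (j.1, 6 * j.2) := by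
    refine iUnion₂_subset fun i hi => ?_
    obtain ⟨j, hj, hij⟩ := hcov i hi
    intro x hx
    simp only [mem_iUnion]
    refine ⟨j, hj, ?_⟩
    have hx' := hij (Metric.ball_subset_closedBall hx)
    have hpos : (0 : ℝ) ≤ 5 * (j.2 : ℝ) := Metric.nonempty_closedBall.1 ⟨x, hx'⟩
    have hne : (j.2 : ℝ) ≠ 0 := by
      intro h0
      have := hF j (huF hj)
      have hz : volume (hlB E j) = 0 := by simp [hlB, h0]
      unfold hlA at this
      rw [setLIntegral_measure_zero _ _ hz] at this
      simp at this
    unfold hlB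
    simp only [Metric.mem_ball, Metric.mem_closedBall] at hx' ⊢
    push_cast
    have : (0 : ℝ) < j.2 := lt_of_le_of_ne (by linarith) (Ne.symm hne)
    linarith
  have hB : ∀ j ∈ u, l * ∫⁻ x in hlB E (j.1, 6 * j.2), φ x
      ≤ hlC E * ∫⁻ x in hlB E j, g x * hlM φ x := by
    intro j hj
    have hFj := hF j (huF hj)
    by_cases hne : (hlB E j).Nonempty
    swap
    · rw [Set.not_nonempty_iff_eq_empty] at hne
      unfold hlA at hFj
      simp [hne] at hFj
    obtain ⟨x0, hx0⟩ := hne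
    obtain ⟨h0, h1⟩ := hlB_pos hx0
    have hr : (0 : ℝ) < j.2 := Metric.pos_of_mem_ball hx0
    have hvol : volume (hlB E (j.1, 6 * j.2)) = hlC E * volume (hlB E j) := by
      unfold hlB hlC
      push_cast
      rw [Measure.addHaar_ball _ _ (by positivity), Measure.addHaar_ball _ _ hr.le, mul_pow,
        ENNReal.ofReal_mul (by positivity), mul_assoc]
    have hl : l * volume (hlB E j) ≤ ∫⁻ x in hlB E j, g x := by
      calc l * volume (hlB E j) ≤ hlA g j * volume (hlB E j) := by gcongr
        _ = _ := by
          unfold hlA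
          rw [mul_right_comm, ENNReal.inv_mul_cancel h0 h1, one_mul]
    have hsub : hlB E j ⊆ hlB E (j.1, 6 * j.2) := by
      unfold hlB
      refine Metric.ball_subset_ball ?_
      push_cast; linarith
    have hlow : ∀ x ∈ hlB E j, hlA φ (j.1, 6 * j.2) ≤ hlM φ x := fun x hx =>
      hlA_le_hlM φ _ (hsub hx)
    obtain ⟨h0', h1'⟩ := hlB_pos (hsub hx0)
    calc l * ∫⁻ x in hlB E (j.1, 6 * j.2), φ x
        = l * (volume (hlB E (j.1, 6 * j.2)) * hlA φ (j.1, 6 * j.2)) := by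
          conv_rhs => unfold hlA
          rw [← mul_assoc (volume _), ENNReal.mul_inv_cancel h0' h1', one_mul]
      _ = hlC E * ((l * volume (hlB E j)) * hlA φ (j.1, 6 * j.2)) := by rw [hvol]; ring
      _ ≤ hlC E * ((∫⁻ x in hlB E j, g x) * hlA φ (j.1, 6 * j.2)) := by gcongr
      _ ≤ hlC E * (∫⁻ x in hlB E j, g x * hlA φ (j.1, 6 * j.2)) := by
          gcongr
          exact lintegral_mul_const_le _ _
      _ ≤ _ := by
          gcongr 1
          exact setLIntegral_mono' (hlB_meas j) fun x hx => mul_le_mul_right (hlow x hx) _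
  calc l * ∫⁻ x in ⋃ i ∈ F, hlB E i, φ x
      ≤ l * ∫⁻ x in ⋃ j ∈ u, hlB E (j.1, 6 * j.2), φ x := by
        gcongr 1
        exact lintegral_mono_set hcov'
    _ ≤ l * ∑' j : u, ∫⁻ x in hlB E (j.1.1, 6 * j.1.2), φ x := by
        gcongr 1
        rw [biUnion_eq_iUnion]
        exact lintegral_iUnion_le _ _
    _ = ∑' j : u, l * ∫⁻ x in hlB E (j.1.1, 6 * j.1.2), φ x := by rw [ENNReal.tsum_mul_left]
    _ ≤ ∑' j : u, hlC E * ∫⁻ x in hlB E j.1, g x * hlM φ x :=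
        ENNReal.tsum_le_tsum fun j => hB j.1 j.2
    _ = hlC E * ∑' j : u, ∫⁻ x in hlB E j.1, g x * hlM φ x := by rw [ENNReal.tsum_mul_left]
    _ = hlC E * ∫⁻ x in ⋃ j : u, hlB E j.1, g x * hlM φ x := by
        rw [lintegral_iUnion (fun j => hlB_meas _)]
        intro a b hab
        refine Disjoint.mono Metric.ball_subset_closedBall Metric.ball_subset_closedBall
          (hdisj a.2 b.2 fun h => hab (Subtype.ext h))
    _ ≤ _ := by
        gcongr 1
        exact setLIntegral_le_lintegral _ _

theorem hl_weak {g φ : E → ℝ≥0∞} (l : ℝ≥0∞) :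
    l * ∫⁻ x in {x | l < hlM g x}, φ x ≤ hlC E * ∫⁻ x, g x * hlM φ x := by
  classical
  have hset : {x | l < hlM g x} = ⋃ i ∈ {i | l < hlA g i}, hlB E i := by
    ext x
    simp only [mem_ofPred_eq, hlM, lt_iSup_iff, mem_iUnion]
    constructor
    · rintro ⟨i, hi⟩
      by_cases hx : x ∈ hlB E i
      · exact ⟨i, by simpa [hx] using hi, hx⟩
      · simp [hx] at hi
    · rintro ⟨i, hi, hx⟩
      exact ⟨i, by simpa [hx] using hi⟩
  rw [hset]
  set S : Set (ℕ × ℚ) := {i | l < hlA g i}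
  have h2 : (⋃ i ∈ S, hlB E i) = ⋃ F : Finset S, ⋃ i ∈ F.map (Function.Embedding.subtype _), hlB E i := by
    ext x
    simp only [mem_iUnion, Finset.mem_map]
    constructor
    · rintro ⟨i, hi, hx⟩
      exact ⟨{⟨i, hi⟩}, i, ⟨⟨i, hi⟩, by simp⟩, hx⟩
    · rintro ⟨F, i, ⟨a, _, rfl⟩, hx⟩
      exact ⟨_, a.2, hx⟩
  rw [h2, setLIntegral_iUnion_of_directed, ENNReal.mul_iSup]
  · refine iSup_le fun F => hl_weak_fin l _ ?_
    intro i hi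
    simp only [Finset.mem_map] at hi
    obtain ⟨a, _, rfl⟩ := hi
    exact a.2
  · refine Monotone.directed_le fun F G h => ?_
    refine iUnion₂_subset fun i hi => ?_
    exact subset_iUnion₂_of_subset i (Finset.map_subset_map.2 h hi) (le_refl _)

theorem layer_real (r : ℝ) (hr : 0 < r) (A : ℝ) (hA : 0 ≤ A) :
    ∫⁻ l in Ioi (0 : ℝ), (if ENNReal.ofReal l < ENNReal.ofReal A then ENNReal.ofReal (l ^ (r - 1)) else 0)
      = ENNReal.ofReal (A ^ r / r) := by
  have h1 : ∫⁻ l in Ioi (0 : ℝ), (if ENNReal.ofReal l < ENNReal.ofReal A then ENNReal.ofReal (l ^ (r - 1)) else 0)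
      = ∫⁻ l in Ioi (0 : ℝ), (Iio A).indicator (fun l => ENNReal.ofReal (l ^ (r - 1))) l := by
    refine setLIntegral_congr_fun measurableSet_Ioi fun l hl => ?_
    simp only [indicator, mem_Iio]
    have : ENNReal.ofReal l < ENNReal.ofReal A ↔ l < A := ENNReal.ofReal_lt_ofReal_iff_of_nonneg (le_of_lt hl)
    simp only [this]
  rw [h1, setLIntegral_indicator measurableSet_Iio, Set.inter_comm, Ioi_inter_Iio,
    restrict_Ioo_eq_restrict_Ioc]
  have hint : IntervalIntegrable (fun l : ℝ => l ^ (r - 1)) volume 0 A :=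
    intervalIntegral.intervalIntegrable_rpow' (by linarith)
  rw [intervalIntegrable_iff_integrableOn_Ioc_of_le hA] at hint
  rw [← ofReal_integral_eq_lintegral_ofReal hint, ← intervalIntegral.integral_of_le hA,
    integral_rpow (Or.inl (by linarith))]
  · simp [Real.zero_rpow hr.ne']
  · rw [Filter.EventuallyLE, ae_restrict_iff' measurableSet_Ioc]
    exact ae_of_all _ fun l hl => Real.rpow_nonneg hl.1.le _

theorem layer (r : ℝ) (hr : 0 < r) (a : ℝ≥0∞) :
    ∫⁻ l in Ioi (0 : ℝ), (if ENNReal.ofReal l < a then ENNReal.ofReal (l ^ (r - 1)) else 0)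
      = a ^ r / ENNReal.ofReal r := by
  by_cases ha : a = ∞
  · subst ha
    rw [ENNReal.top_rpow_of_pos hr, ENNReal.top_div_of_ne_top ENNReal.ofReal_ne_top]
    rw [eq_top_iff]
    have key : ∀ A : ℝ, 0 ≤ A → ENNReal.ofReal (A ^ r / r) ≤
        ∫⁻ l in Ioi (0 : ℝ), (if ENNReal.ofReal l < ∞ then ENNReal.ofReal (l ^ (r - 1)) else 0) := by
      intro A hA
      rw [← layer_real r hr A hA]
      refine lintegral_mono fun l => ?_
      dsimp only
      split_ifs with h1 h2
      · exact le_rfl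
      · exact absurd ENNReal.ofReal_lt_top h2
      · exact zero_le
      · exact le_rfl
    refine ENNReal.le_of_forall_nnreal_lt fun x _ => ?_
    have := key ((x * r) ^ (1 / r)) (by positivity)
    rw [← Real.rpow_mul (by positivity), one_div, inv_mul_cancel₀ hr.ne', Real.rpow_one,
      mul_div_cancel_right₀ _ hr.ne', ENNReal.ofReal_coe_nnreal] at this
    exact this
  · lift a to NNReal using ha
    have := layer_real r hr a a.2
    rw [ENNReal.ofReal_coe_nnreal] at this
    rw [this, ENNReal.ofReal_div_of_pos hr, ← ENNReal.ofReal_rpow_of_nonneg (NNReal.coe_nonneg a) hr.le,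
      ENNReal.ofReal_coe_nnreal]

/-- strong type constant -/
def hlK (E : Type*) [NormedAddCommGroup E] [NormedSpace ℝ E] (p : ℝ) : ℝ≥0∞ :=
  ENNReal.ofReal p * (2 * hlC E * (2 ^ (p - 1) / ENNReal.ofReal (p - 1)))

theorem hlK_ne_top (p : ℝ) (hp : 1 < p) : hlK E p ≠ ∞ := by
  unfold hlK hlC
  refine ENNReal.mul_ne_top ENNReal.ofReal_ne_top (ENNReal.mul_ne_top
    (ENNReal.mul_ne_top (by simp) ENNReal.ofReal_ne_top) (ENNReal.div_ne_top ?_ ?_))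
  · exact ENNReal.rpow_ne_top_of_nonneg (by linarith) (by simp)
  · simpa using hp

theorem hl_weak' {g φ : E → ℝ≥0∞} (hg : Measurable g) (l : ℝ) (hl : 0 < l) :
    ∫⁻ x in {x | ENNReal.ofReal l < hlM g x}, φ x ≤
      (ENNReal.ofReal l)⁻¹ * (2 * hlC E * ∫⁻ x, (if ENNReal.ofReal l < 2 * g x then g x else 0) * hlM φ x) := by
  set L := ENNReal.ofReal l with hL
  have hL0 : L ≠ 0 := by simpa [hL] using hl
  have hLt : L ≠ ∞ := ENNReal.ofReal_ne_top
  set g1 : E → ℝ≥0∞ := fun x => if L < 2 * g x then g x else 0 with hg1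
  have hg1m : Measurable g1 :=
    Measurable.ite (measurableSet_lt measurable_const (hg.const_mul 2)) hg measurable_const
  have hsub : {x | L < hlM g x} ⊆ {x | L / 2 < hlM g1 x} := by
    intro x hx
    simp only [mem_ofPred_eq] at hx ⊢
    by_contra hcon
    push Not at hcon
    have h1 : hlM g x ≤ hlM (fun y => g1 y + L / 2) x := by
      refine hlM_mono (ae_of_all _ fun y => ?_) x
      simp only [hg1]
      split_ifs with h
      · exact le_self_add
      · push Not at h
        rw [zero_add, ENNReal.le_div_iff_mul_le (by simp) (by simp), mul_comm]
        exact h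
    have h2 := h1.trans (hlM_add_le hg1m x)
    have h3 : hlM g1 x + hlM (fun _ : E => L / 2) x ≤ L / 2 + L / 2 :=
      add_le_add hcon (hlM_const_le _ _)
    rw [ENNReal.add_halves] at h3
    exact absurd (h2.trans h3) (not_le.2 hx)
  have hw := hl_weak (g := g1) (φ := φ) (L / 2)
  calc ∫⁻ x in {x | L < hlM g x}, φ x ≤ ∫⁻ x in {x | L / 2 < hlM g1 x}, φ x := lintegral_mono_set hsub
    _ = L⁻¹ * (2 * ((L / 2) * ∫⁻ x in {x | L / 2 < hlM g1 x}, φ x)) := by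
      rw [← mul_assoc 2, ENNReal.mul_div_cancel (by simp) (by simp), ← mul_assoc,
        ENNReal.inv_mul_cancel hL0 hLt, one_mul]
    _ ≤ L⁻¹ * (2 * (hlC E * ∫⁻ x, g1 x * hlM φ x)) := by gcongr
    _ = _ := by rw [mul_assoc 2]

theorem hl_strong (p : ℝ) (hp : 1 < p) {g φ : E → ℝ≥0∞} (hg : Measurable g) (hφ : Measurable φ) :
    ∫⁻ x, hlM g x ^ p * φ x ≤ hlK E p * ∫⁻ x, g x ^ p * hlM φ x := by
  have hp0 : 0 < p := by linarith
  have hpp : ENNReal.ofReal p ≠ 0 := by simpa using hp0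
  have hrm : ∀ r : ℝ, Measurable fun l : ℝ => ENNReal.ofReal (l ^ r) := fun r => by fun_prop
  have e1 : ∀ x, hlM g x ^ p * φ x = ENNReal.ofReal p *
      ∫⁻ l in Ioi (0 : ℝ), (if ENNReal.ofReal l < hlM g x then ENNReal.ofReal (l ^ (p - 1)) else 0) * φ x := by
    intro x
    rw [lintegral_mul_const _ (Measurable.ite (measurableSet_lt (by fun_prop) measurable_const) (hrm _) measurable_const),
      layer p hp0, ← mul_assoc, ENNReal.mul_div_cancel hpp ENNReal.ofReal_ne_top]
  have hMm := hlM_meas g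
  have hMφ := hlM_meas φ
  calc ∫⁻ x, hlM g x ^ p * φ x
      = ENNReal.ofReal p * ∫⁻ x, ∫⁻ l in Ioi (0 : ℝ),
          (if ENNReal.ofReal l < hlM g x then ENNReal.ofReal (l ^ (p - 1)) else 0) * φ x := by
        simp_rw [e1]
        rw [lintegral_const_mul' _ _ ENNReal.ofReal_ne_top]
    _ = ENNReal.ofReal p * ∫⁻ l in Ioi (0 : ℝ), ∫⁻ x,
          (if ENNReal.ofReal l < hlM g x then ENNReal.ofReal (l ^ (p - 1)) else 0) * φ x := by
        rw [lintegral_lintegral_swap]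
        refine Measurable.aemeasurable ?_
        refine Measurable.mul ?_ (hφ.comp measurable_fst)
        exact Measurable.ite (measurableSet_lt (by fun_prop) (hMm.comp measurable_fst))
          ((hrm _).comp measurable_snd) measurable_const
    _ ≤ ENNReal.ofReal p * ∫⁻ l in Ioi (0 : ℝ), 2 * hlC E * ∫⁻ x,
          (if ENNReal.ofReal l < 2 * g x then ENNReal.ofReal (l ^ (p - 1 - 1)) else 0) * (g x * hlM φ x) := by
        gcongr 1
        refine setLIntegral_mono' measurableSet_Ioi fun l hl => ?_
        have hl : 0 < l := hl
        have hw := hl_weak' (φ := φ) hg l hl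
        have hpow : ENNReal.ofReal (l ^ (p - 1)) * (ENNReal.ofReal l)⁻¹ = ENNReal.ofReal (l ^ (p - 1 - 1)) := by
          rw [← ENNReal.ofReal_inv_of_pos hl, ← ENNReal.ofReal_mul (by positivity),
            Real.rpow_sub_one hl.ne' (p - 1)]
          rfl
        calc ∫⁻ x, (if ENNReal.ofReal l < hlM g x then ENNReal.ofReal (l ^ (p - 1)) else 0) * φ x
            = ∫⁻ x, ENNReal.ofReal (l ^ (p - 1)) * ({x | ENNReal.ofReal l < hlM g x}.indicator φ x) := by
              refine lintegral_congr fun x => ?_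
              simp only [indicator, mem_ofPred_eq]
              split_ifs <;> simp
          _ = ENNReal.ofReal (l ^ (p - 1)) * ∫⁻ x in {x | ENNReal.ofReal l < hlM g x}, φ x := by
              rw [lintegral_const_mul' _ _ ENNReal.ofReal_ne_top,
                lintegral_indicator (measurableSet_lt measurable_const hMm)]
          _ ≤ _ := mul_le_mul_right hw _
          _ = 2 * hlC E * (ENNReal.ofReal (l ^ (p - 1 - 1)) *
              ∫⁻ x, (if ENNReal.ofReal l < 2 * g x then g x else 0) * hlM φ x) := by
              rw [← mul_assoc, hpow]; ring
          _ = _ := by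
              rw [← lintegral_const_mul' _ _ ENNReal.ofReal_ne_top]
              congr 1
              refine lintegral_congr fun x => ?_
              split_ifs <;> ring
    _ = ENNReal.ofReal p * (2 * hlC E * ∫⁻ x, ∫⁻ l in Ioi (0 : ℝ),
          (if ENNReal.ofReal l < 2 * g x then ENNReal.ofReal (l ^ (p - 1 - 1)) else 0) * (g x * hlM φ x)) := by
        rw [lintegral_const_mul' _ _ (show 2 * hlC E ≠ ∞ from ENNReal.mul_ne_top (by simp) ENNReal.ofReal_ne_top),
          lintegral_lintegral_swap]
        refine Measurable.aemeasurable ?_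
        refine Measurable.mul ?_ ((hg.mul hMφ).comp measurable_snd)
        exact Measurable.ite (measurableSet_lt (by fun_prop) ((hg.const_mul 2).comp measurable_snd))
          ((hrm _).comp measurable_fst) measurable_const
    _ = ENNReal.ofReal p * (2 * hlC E * ∫⁻ x, 2 ^ (p - 1) / ENNReal.ofReal (p - 1) * (g x ^ p * hlM φ x)) := by
        congr 2
        refine lintegral_congr fun x => ?_
        rw [lintegral_mul_const _ (Measurable.ite (measurableSet_lt (by fun_prop) measurable_const) (hrm _) measurable_const),
          layer (p - 1) (by linarith), ENNReal.mul_rpow_of_nonneg _ _ (by linarith)]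
        have : g x ^ p = g x ^ (p - 1) * g x := by
          conv_rhs => rw [← ENNReal.rpow_one (g x), ← ENNReal.rpow_mul, one_mul, ← ENNReal.rpow_add_of_nonneg _ _ (by linarith) zero_le_one]
          congr 1; ring
        rw [this, div_eq_mul_inv, div_eq_mul_inv]; ring
    _ = _ := by
        rw [lintegral_const_mul _ (show Measurable fun x => g x ^ p * hlM φ x from (hg.pow_const p).mul hMφ)]
        unfold hlK; ring

theorem hl_strong1 (p : ℝ) (hp : 1 < p) {g : E → ℝ≥0∞} (hg : Measurable g) :
    ∫⁻ x, hlM g x ^ p ≤ hlK E p * ∫⁻ x, g x ^ p := by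
  have h := hl_strong p hp hg (φ := fun _ : E => 1) measurable_const
  simp only [mul_one] at h
  refine h.trans ?_
  gcongr with x
  exact mul_le_of_le_one_right' (hlM_const_le 1 x)


theorem rdf (q : ℝ) (hq : 1 < q) {w : E → ℝ≥0∞} (hw : Measurable w) :
    ∃ v : E → ℝ≥0∞, Measurable v ∧ (∀ t, w t ≤ v t) ∧ (∀ t, hlM v t ≤ 4 * (1 + hlK E q) * v t) ∧
      ∫⁻ t, v t ^ q ≤ 2 ^ q * 2 * ∫⁻ t, w t ^ q := by
  have hq0 : 0 < q := by linarith
  set B : ℝ≥0∞ := 1 + hlK E q with hB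
  have hBt : B ≠ ∞ := ENNReal.add_ne_top.2 ⟨by simp, hlK_ne_top q hq⟩
  have hB1 : 1 ≤ B := le_self_add
  have hB0 : B ≠ 0 := (lt_of_lt_of_le zero_lt_one hB1).ne'
  set m : ℕ → E → ℝ≥0∞ := fun k => hlM^[k] w with hm
  have hm0 : m 0 = w := rfl
  have hms : ∀ k, m (k + 1) = hlM (m k) := fun k => Function.iterate_succ_apply' _ _ _
  have hmm : ∀ k, Measurable (m k) := by
    intro k
    cases k with
    | zero => exact hw
    | succ k => rw [hms]; exact hlM_meas _
  have hmn : ∀ k, ∫⁻ t, m k t ^ q ≤ B ^ k * ∫⁻ t, w t ^ q := by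
    intro k
    induction k with
    | zero => simp [hm0]
    | succ k ih =>
      rw [hms, pow_succ']
      calc _ ≤ hlK E q * ∫⁻ t, m k t ^ q := hl_strong1 q hq (hmm k)
        _ ≤ B * (B ^ k * ∫⁻ t, w t ^ q) := mul_le_mul' le_add_self ih
        _ = _ := by ring
  have h4t : 4 * B ≠ ∞ := ENNReal.mul_ne_top (by simp) hBt
  have h40 : 4 * B ≠ 0 := mul_ne_zero (by simp) hB0
  refine ⟨fun t => ∑' k, ((4 * B)⁻¹) ^ k * m k t, ?_, ?_, ?_, ?_⟩
  · exact Measurable.tsum fun k => (hmm k).const_mul _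
  · intro t
    refine le_trans ?_ (ENNReal.le_tsum 0)
    simp [hm0]
  · intro t
    refine (hlM_tsum_le (fun k => (hmm k).const_mul _) t).trans ?_
    calc ∑' k, hlM (fun y => ((4 * B)⁻¹) ^ k * m k y) t
        ≤ ∑' k, (4 * B) * (((4 * B)⁻¹) ^ (k + 1) * m (k + 1) t) := by
          refine ENNReal.tsum_le_tsum fun k => ?_
          refine (hlM_const_mul_le (hmm k) _ t).trans ?_
          rw [hms, pow_succ', ← mul_assoc, ← mul_assoc, ENNReal.mul_inv_cancel h40 h4t, one_mul]
      _ = (4 * B) * ∑' k, (((4 * B)⁻¹) ^ (k + 1) * m (k + 1) t) := ENNReal.tsum_mul_left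
      _ ≤ _ := by
          gcongr 1
          exact ENNReal.tsum_comp_le_tsum_of_injective (add_left_injective 1)
            (fun k => ((4 * B)⁻¹) ^ k * m k t)
  · set c : ℕ → E → ℝ≥0∞ := fun k t => ((2 * B)⁻¹) ^ k * m k t with hc
    have hcm : ∀ k, Measurable (c k) := fun k => (hmm k).const_mul _
    have hpt : ∀ t, (∑' k, ((4 * B)⁻¹) ^ k * m k t) ^ q ≤ 2 ^ q * ∑' k, c k t ^ q := by
      intro t
      have h1 : ∀ k, c k t ≤ (∑' k, c k t ^ q) ^ (1 / q) := by
        intro k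
        rw [one_div, ENNReal.le_rpow_inv_iff hq0]
        exact ENNReal.le_tsum (f := fun k => c k t ^ q) k
      have h2 : ∑' k, ((4 * B)⁻¹) ^ k * m k t ≤ 2 * (∑' k, c k t ^ q) ^ (1 / q) := by
        calc ∑' k, ((4 * B)⁻¹) ^ k * m k t = ∑' k, (2⁻¹ : ℝ≥0∞) ^ k * c k t := by
              refine tsum_congr fun k => ?_
              have : (4 * B)⁻¹ = (2⁻¹ : ℝ≥0∞) * (2 * B)⁻¹ := by
                rw [← ENNReal.mul_inv (by simp) (by simp), ← mul_assoc]
                norm_num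
              rw [this, mul_pow, hc, mul_assoc]
          _ ≤ ∑' k, (2⁻¹ : ℝ≥0∞) ^ k * (∑' k, c k t ^ q) ^ (1 / q) :=
              ENNReal.tsum_le_tsum fun k => mul_le_mul_right (h1 k) _
          _ = _ := by
              rw [ENNReal.tsum_mul_right, ENNReal.tsum_geometric]
              simp
      calc _ ≤ (2 * (∑' k, c k t ^ q) ^ (1 / q)) ^ q := ENNReal.rpow_le_rpow h2 hq0.le
        _ = _ := by
          rw [ENNReal.mul_rpow_of_nonneg _ _ hq0.le, ← ENNReal.rpow_mul, one_div,
            inv_mul_cancel₀ hq0.ne', ENNReal.rpow_one]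
    calc ∫⁻ t, (∑' k, ((4 * B)⁻¹) ^ k * m k t) ^ q ≤ ∫⁻ t, 2 ^ q * ∑' k, c k t ^ q := lintegral_mono hpt
      _ = 2 ^ q * ∑' k, ∫⁻ t, c k t ^ q := by
          rw [lintegral_const_mul _ (Measurable.tsum fun k => (hcm k).pow_const q),
            lintegral_tsum fun k => ((hcm k).pow_const q).aemeasurable]
      _ ≤ 2 ^ q * ∑' k : ℕ, (2⁻¹ : ℝ≥0∞) ^ k * ∫⁻ t, w t ^ q := by
          gcongr with k
          simp only [hc]
          simp_rw [ENNReal.mul_rpow_of_nonneg _ _ hq0.le]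
          rw [lintegral_const_mul _ ((hmm k).pow_const q)]
          have hle1 : ((2 * B)⁻¹) ^ k ≤ 1 := by
            refine pow_le_one' (ENNReal.inv_le_one.2 ?_) k
            exact hB1.trans (by rw [two_mul]; exact le_self_add)
          calc (((2 * B)⁻¹) ^ k) ^ q * ∫⁻ t, m k t ^ q
              ≤ ((2 * B)⁻¹) ^ k * (B ^ k * ∫⁻ t, w t ^ q) := by
                refine mul_le_mul' ?_ (hmn k)
                exact ENNReal.rpow_le_self_of_le_one hle1 hq.le
            _ = _ := by
                rw [ENNReal.mul_inv (by simp) (by simp), mul_pow, mul_assoc, ← mul_assoc (B⁻¹ ^ k), ← mul_pow,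
                  ENNReal.inv_mul_cancel hB0 hBt, one_pow, one_mul]
      _ = _ := by
          rw [ENNReal.tsum_mul_right, ENNReal.tsum_geometric, mul_assoc]
          simp

theorem hlM_holder (p q : ℝ) (hq : 1 < q) (hqp : q < p) {v u : E → ℝ≥0∞} (hv : Measurable v)
    (hu : Measurable u) (D : ℝ≥0∞) (hvD : ∀ t, hlM v t ≤ D * v t) (hv0 : ∀ t, v t ≠ 0)
    (hvt : ∀ᵐ t, v t ≠ ∞) (t : E) :
    hlM u t ≤ (hlM (fun s => u s ^ (p / q) * v s ^ (1 - p / q)) t) ^ (q / p) * (D * v t) ^ (1 - q / p) := by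
  have hq0 : 0 < q := by linarith
  have hp0 : 0 < p := by linarith
  have hθ : 0 < q / p := by positivity
  have hθ1 : q / p < 1 := (div_lt_one hp0).2 hqp
  set F : E → ℝ≥0∞ := fun s => u s ^ (p / q) * v s ^ (1 - p / q) with hF
  have hFm : Measurable F := (hu.pow_const _).mul (hv.pow_const _)
  have hpt : ∀ᵐ s, u s = F s ^ (q / p) * v s ^ (1 - q / p) := by
    filter_upwards [hvt] with s hs
    simp only [hF]
    rw [ENNReal.mul_rpow_of_nonneg _ _ hθ.le, ← ENNReal.rpow_mul, ← ENNReal.rpow_mul, mul_assoc,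
      ← ENNReal.rpow_add _ _ (hv0 s) hs]
    have e1 : p / q * (q / p) = 1 := by field_simp
    have e2 : (1 - p / q) * (q / p) + (1 - q / p) = 0 := by field_simp; ring
    rw [e1, e2]; simp
  refine hlM_le fun i hi => ?_
  obtain ⟨h0, h1⟩ := hlB_pos hi
  calc hlA u i ≤ (hlA F i) ^ (q / p) * (hlA v i) ^ (1 - q / p) := by
        unfold hlA
        have hh := ENNReal.lintegral_mul_norm_pow_le (μ := volume.restrict (hlB E i)) hFm.aemeasurable hv.aemeasurable
          hθ.le (by linarith : 0 ≤ 1 - q / p) (by ring)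
        rw [← lintegral_congr_ae (ae_restrict_of_ae hpt)] at hh
        rw [ENNReal.mul_rpow_of_nonneg _ _ hθ.le, ENNReal.mul_rpow_of_nonneg _ _ (by linarith : 0 ≤ 1 - q / p),
          mul_mul_mul_comm, ← ENNReal.rpow_add_of_nonneg _ _ hθ.le (by linarith)]
        have : q / p + (1 - q / p) = 1 := by ring
        rw [this, ENNReal.rpow_one]
        exact mul_le_mul_right hh _
    _ ≤ _ := by
        refine mul_le_mul' (ENNReal.rpow_le_rpow (hlA_le_hlM F i hi) hθ.le)
          (ENNReal.rpow_le_rpow ((hlA_le_hlM v i hi).trans (hvD t)) (by linarith))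

theorem rpow_mul_rpow_neg_le (v : ℝ≥0∞) (a b : ℝ) (ha : 0 < a) (hb : b < 0) :
    v ^ a * v ^ b ≤ v ^ (a + b) := by
  by_cases h0 : v = 0
  · simp [h0, ENNReal.zero_rpow_of_pos ha]
  by_cases h1 : v = ∞
  · simp [h1, ENNReal.top_rpow_of_neg hb]
  rw [ENNReal.rpow_add _ _ h0 h1]

theorem hl_weighted (p q : ℝ) (hq : 1 < q) (hqp : q < p) {v u : E → ℝ≥0∞} (hv : Measurable v)
    (hu : Measurable u) (D : ℝ≥0∞) (hvD : ∀ t, hlM v t ≤ D * v t) (hv0 : ∀ t, v t ≠ 0)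
    (hvt : ∀ᵐ t, v t ≠ ∞) :
    ∫⁻ t, hlM u t ^ p * v t ^ (q - p) ≤ D ^ (p - q) * hlK E q * ∫⁻ t, u t ^ p * v t ^ (q - p) := by
  have hq0 : 0 < q := by linarith
  have hp0 : 0 < p := by linarith
  set F : E → ℝ≥0∞ := fun s => u s ^ (p / q) * v s ^ (1 - p / q) with hF
  have hFm : Measurable F := (hu.pow_const _).mul (hv.pow_const _)
  have hpt : ∀ t, hlM u t ^ p * v t ^ (q - p) ≤ D ^ (p - q) * hlM F t ^ q := by
    intro t
    have h := ENNReal.rpow_le_rpow (hlM_holder p q hq hqp hv hu D hvD hv0 hvt t) hp0.le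
    rw [ENNReal.mul_rpow_of_nonneg _ _ hp0.le, ← ENNReal.rpow_mul, ← ENNReal.rpow_mul] at h
    have e1 : q / p * p = q := by field_simp
    have e2 : (1 - q / p) * p = p - q := by field_simp
    rw [e1, e2, ENNReal.mul_rpow_of_nonneg _ _ (by linarith : 0 ≤ p - q)] at h
    calc _ ≤ hlM F t ^ q * (D ^ (p - q) * v t ^ (p - q)) * v t ^ (q - p) := mul_le_mul_left h _
      _ = D ^ (p - q) * hlM F t ^ q * (v t ^ (p - q) * v t ^ (q - p)) := by ring
      _ ≤ D ^ (p - q) * hlM F t ^ q * 1 := by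
          gcongr
          refine (rpow_mul_rpow_neg_le _ _ _ (by linarith) (by linarith)).trans ?_
          simp
      _ = _ := mul_one _
  have hFq : ∀ t, F t ^ q = u t ^ p * v t ^ (q - p) := by
    intro t
    simp only [hF]
    rw [ENNReal.mul_rpow_of_nonneg _ _ hq0.le, ← ENNReal.rpow_mul, ← ENNReal.rpow_mul]
    congr 2 <;> field_simp
  calc _ ≤ ∫⁻ t, D ^ (p - q) * hlM F t ^ q := lintegral_mono hpt
    _ = D ^ (p - q) * ∫⁻ t, hlM F t ^ q := lintegral_const_mul _ ((hlM_meas F).pow_const q)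
    _ ≤ D ^ (p - q) * (hlK E q * ∫⁻ t, F t ^ q) := by
        gcongr 1
        exact hl_strong1 q hq hFm
    _ = _ := by simp_rw [hFq]; ring

theorem exists_simple_lt {α : Type*} {m : MeasurableSpace α} {μ : Measure α}
    [SigmaFinite μ] {f : α → ℝ≥0∞} {L : ℝ≥0∞} (hL : L < ∫⁻ x, f x ∂μ) :
    ∃ g : SimpleFunc α NNReal, (∀ x, (g x : ℝ≥0∞) ≤ f x) ∧ ∫⁻ x, g x ∂μ < ∞ ∧ L < ∫⁻ x, g x ∂μ := by
  simp_rw [lintegral_eq_nnreal, lt_iSup_iff] at hL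
  rcases hL with ⟨g₀, hg₀, g₀L⟩
  have h'L : L < ∫⁻ x, g₀ x ∂μ := by
    convert! g₀L
    rw [← SimpleFunc.lintegral_eq_lintegral, SimpleFunc.coe_map]
    simp only [Function.comp_apply]
  rcases SimpleFunc.exists_lt_lintegral_simpleFunc_of_lt_lintegral h'L with ⟨g, hg, gL, gtop⟩
  exact ⟨g, fun x => (ENNReal.coe_le_coe.2 (hg x)).trans (hg₀ x), gL, gtop⟩

section VV

variable {X : Type*} [MeasurableSpace X] (ν : Measure X) [SFinite ν]

theorem vv_swap {m : E × X → ℝ≥0∞} (hm : Measurable m) {φ : E → ℝ≥0∞} (hφ : Measurable φ) (p : ℝ) :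
    ∫⁻ t, (∫⁻ x, m (t, x) ^ p ∂ν) * φ t = ∫⁻ x, (∫⁻ t, m (t, x) ^ p * φ t) ∂ν := by
  rw [lintegral_lintegral_swap (f := fun x t => m (t, x) ^ p * φ t)]
  · refine lintegral_congr fun t => ?_
    rw [lintegral_mul_const]
    exact (hm.comp measurable_prodMk_left).pow_const p
  · refine Measurable.aemeasurable ?_
    exact ((hm.comp measurable_swap).pow_const p).mul (hφ.comp measurable_snd)

theorem vv_base (p : ℝ) (hp : 1 < p) {g : E × X → ℝ≥0∞} (hg : Measurable g) {φ : E → ℝ≥0∞} (hφ : Measurable φ) :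
    ∫⁻ t, (∫⁻ x, hlM (fun s => g (s, x)) t ^ p ∂ν) * φ t ≤
      hlK E p * ∫⁻ t, (∫⁻ x, g (t, x) ^ p ∂ν) * hlM φ t := by
  have h1 := vv_swap ν (hlM_meas_param g hg) hφ p
  dsimp only at h1
  rw [h1, vv_swap ν hg (hlM_meas φ) p, ← lintegral_const_mul' _ _ (hlK_ne_top p hp)]
  exact lintegral_mono fun x => hl_strong p hp (hg.comp measurable_prodMk_right) hφ

theorem vv_gt (p q : ℝ) (hp : 1 < p) (hpq : p < q) :
    ∃ C : ℝ≥0∞, C ≠ ∞ ∧ ∀ g : E × X → ℝ≥0∞, Measurable g →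
      ∫⁻ t, (∫⁻ x, hlM (fun s => g (s, x)) t ^ p ∂ν) ^ (q / p) ≤
        C * ∫⁻ t, (∫⁻ x, g (t, x) ^ p ∂ν) ^ (q / p) := by
  have hp0 : 0 < p := by linarith
  set r := q / p with hr
  have hr1 : 1 < r := (one_lt_div hp0).2 hpq
  have hr0 : 0 < r := by linarith
  set b := 1 - 1 / r with hb
  have hb0 : 0 < b := by
    rw [hb, sub_pos, div_lt_one hr0]; exact hr1
  have hb1 : b < 1 := by rw [hb]; linarith [one_div_pos.2 hr0]
  have hb' : 1 < 1 / b := (one_lt_div hb0).2 hb1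
  set A : ℝ≥0∞ := hlK E p * hlK E (1 / b) ^ b with hA
  have hAt : A ≠ ∞ := ENNReal.mul_ne_top (hlK_ne_top p hp)
    (ENNReal.rpow_ne_top_of_nonneg hb0.le (hlK_ne_top _ hb'))
  refine ⟨A ^ r, ENNReal.rpow_ne_top_of_nonneg hr0.le hAt, fun g hg => ?_⟩
  set G : E → ℝ≥0∞ := fun t => ∫⁻ x, hlM (fun s => g (s, x)) t ^ p ∂ν with hG
  set h : E → ℝ≥0∞ := fun t => ∫⁻ x, g (t, x) ^ p ∂ν with hh
  have hGm : Measurable G := ((hlM_meas_param g hg).pow_const p).lintegral_prod_right'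
  have hhm : Measurable h := (hg.pow_const p).lintegral_prod_right'
  refine le_of_forall_lt fun L hL => ?_
  obtain ⟨s, hs, hsfin, hsL⟩ := exists_simple_lt hL
  refine lt_of_lt_of_le hsL ?_
  set J := ∫⁻ t, (s t : ℝ≥0∞) with hJ
  have hsm : Measurable fun t => (s t : ℝ≥0∞) := s.measurable.coe_nnreal_ennreal
  set φ : E → ℝ≥0∞ := fun t => (s t : ℝ≥0∞) ^ b with hφ
  have hφm : Measurable φ := hsm.pow_const b
  have hφb : ∀ t, φ t ^ (1 / b) = s t := by
    intro t
    simp only [hφ]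
    rw [← ENNReal.rpow_mul, mul_one_div_cancel hb0.ne', ENNReal.rpow_one]
  have step : J ≤ A * (∫⁻ t, h t ^ r) ^ (1 / r) * J ^ b := by
    calc J ≤ ∫⁻ t, G t * φ t := by
          refine lintegral_mono fun t => ?_
          have h1 : (s t : ℝ≥0∞) ^ (1 / r) ≤ G t := by
            rw [one_div, ENNReal.rpow_inv_le_iff hr0]; exact hs t
          calc (s t : ℝ≥0∞) = (s t : ℝ≥0∞) ^ (1 / r) * (s t : ℝ≥0∞) ^ b := by
                rw [← ENNReal.rpow_add_of_nonneg _ _ (by positivity) hb0.le, hb]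
                simp
            _ ≤ _ := mul_le_mul_left h1 _
      _ ≤ hlK E p * ∫⁻ t, h t * hlM φ t := vv_base ν p hp hg hφm
      _ = hlK E p * ∫⁻ t, (h t ^ r) ^ (1 / r) * (hlM φ t ^ (1 / b)) ^ b := by
          congr 1
          refine lintegral_congr fun t => ?_
          rw [← ENNReal.rpow_mul, ← ENNReal.rpow_mul, mul_one_div_cancel hr0.ne',
            one_div_mul_cancel hb0.ne', ENNReal.rpow_one, ENNReal.rpow_one]
      _ ≤ hlK E p * ((∫⁻ t, h t ^ r) ^ (1 / r) * (∫⁻ t, hlM φ t ^ (1 / b)) ^ b) := by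
          gcongr 1
          exact ENNReal.lintegral_mul_norm_pow_le (hhm.pow_const r).aemeasurable
            ((hlM_meas φ).pow_const _).aemeasurable (by positivity) hb0.le (by rw [hb]; ring)
      _ ≤ hlK E p * ((∫⁻ t, h t ^ r) ^ (1 / r) * (hlK E (1 / b) * J) ^ b) := by
          gcongr
          refine (hl_strong1 _ hb' hφm).trans ?_
          simp_rw [hφb]
          exact le_rfl
      _ = _ := by
          rw [ENNReal.mul_rpow_of_nonneg _ _ hb0.le, hA]; ring
  by_cases hJ0 : J = 0
  · rw [hJ0]; exact zero_le
  have hJb0 : J ^ b ≠ 0 := by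
    rw [Ne, ENNReal.rpow_eq_zero_iff]; push Not
    exact ⟨fun h => absurd h hJ0, fun _ => hb0.le⟩
  have hJbt : J ^ b ≠ ∞ := ENNReal.rpow_ne_top_of_nonneg hb0.le hsfin.ne
  have hJs : J = J ^ (1 / r) * J ^ b := by
    rw [← ENNReal.rpow_add_of_nonneg _ _ (by positivity) hb0.le, hb]; simp
  conv_lhs at step => rw [hJs]
  rw [ENNReal.mul_le_mul_iff_left hJb0 hJbt] at step
  have := ENNReal.rpow_le_rpow step hr0.le
  rwa [ENNReal.mul_rpow_of_nonneg _ _ hr0.le, ← ENNReal.rpow_mul, ← ENNReal.rpow_mul,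
    one_div_mul_cancel hr0.ne', ENNReal.rpow_one, ENNReal.rpow_one] at this

theorem vv_lt (p q : ℝ) (hq : 1 < q) (hqp : q < p) :
    ∃ C : ℝ≥0∞, C ≠ ∞ ∧ ∀ g : E × X → ℝ≥0∞, Measurable g →
      ∫⁻ t, (∫⁻ x, hlM (fun s => g (s, x)) t ^ p ∂ν) ^ (q / p) ≤
        C * ∫⁻ t, (∫⁻ x, g (t, x) ^ p ∂ν) ^ (q / p) := by
  have hq0 : 0 < q := by linarith
  have hp0 : 0 < p := by linarith
  set θ := q / p with hθ
  have hθ0 : 0 < θ := by positivity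
  have hθ1 : θ < 1 := (div_lt_one hp0).2 hqp
  set D : ℝ≥0∞ := 4 * (1 + hlK E q) with hD
  have hDt : D ≠ ∞ := ENNReal.mul_ne_top (by simp) (ENNReal.add_ne_top.2 ⟨by simp, hlK_ne_top q hq⟩)
  set A : ℝ≥0∞ := D ^ (p - q) * hlK E q with hA
  have hAt : A ≠ ∞ := ENNReal.mul_ne_top (ENNReal.rpow_ne_top_of_nonneg (by linarith) hDt) (hlK_ne_top q hq)
  set C : ℝ≥0∞ := A ^ θ * (2 ^ q * 2) with hC
  have hCt : C ≠ ∞ := ENNReal.mul_ne_top (ENNReal.rpow_ne_top_of_nonneg hθ0.le hAt)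
    (ENNReal.mul_ne_top (ENNReal.rpow_ne_top_of_nonneg hq0.le (by simp)) (by simp))
  refine ⟨C, hCt, fun g hg => ?_⟩
  set G : E → ℝ≥0∞ := fun t => ∫⁻ x, hlM (fun s => g (s, x)) t ^ p ∂ν with hG
  set h : E → ℝ≥0∞ := fun t => ∫⁻ x, g (t, x) ^ p ∂ν with hh
  have hGm : Measurable G := ((hlM_meas_param g hg).pow_const p).lintegral_prod_right'
  have hhm : Measurable h := (hg.pow_const p).lintegral_prod_right'
  by_cases hHt : ∫⁻ t, h t ^ θ = ∞
  · have hC0 : C ≠ 0 := by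
      have hK0 : hlK E q ≠ 0 := by
        unfold hlK hlC
        refine mul_ne_zero (by simpa using hq0) (mul_ne_zero (mul_ne_zero (by simp) (by simp)) ?_)
        refine (ENNReal.div_pos ?_ ENNReal.ofReal_ne_top).ne'
        exact (ENNReal.rpow_pos (by simp) (by simp)).ne'
      have hD0 : D ≠ 0 := mul_ne_zero (by simp) (by simp)
      have hA0 : A ≠ 0 := mul_ne_zero (ENNReal.rpow_pos (pos_iff_ne_zero.2 hD0) hDt).ne' hK0
      exact mul_ne_zero (ENNReal.rpow_pos (pos_iff_ne_zero.2 hA0) hAt).ne'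
        (mul_ne_zero (ENNReal.rpow_pos (by simp) (by simp)).ne' (by simp))
    rw [hHt, ENNReal.mul_top hC0]
    exact le_top
  have key : ∀ ε : ℝ≥0∞, ε ≠ 0 → ε ≠ ∞ → ∫⁻ t, G t ^ θ ≤ C * ((∫⁻ t, h t ^ θ) + ε) := by
    intro ε hε hεt
    obtain ⟨e, he0, hem, heε⟩ := exists_pos_lintegral_lt_of_sigmaFinite (volume : Measure E) hε
    set w : E → ℝ≥0∞ := fun t => (h t ^ θ + e t) ^ (1 / q) with hw
    have hem' : Measurable fun t => (e t : ℝ≥0∞) := hem.coe_nnreal_ennreal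
    have hwm : Measurable w := ((hhm.pow_const θ).add hem').pow_const _
    have hwq : ∀ t, w t ^ q = h t ^ θ + e t := by
      intro t
      simp only [hw]
      rw [← ENNReal.rpow_mul, one_div_mul_cancel hq0.ne', ENNReal.rpow_one]
    have hwW : ∫⁻ t, w t ^ q ≤ (∫⁻ t, h t ^ θ) + ε := by
      simp_rw [hwq]
      rw [lintegral_add_left (hhm.pow_const θ)]
      gcongr
    have hhw : ∀ t, h t ≤ w t ^ p := by
      intro t
      have h1 : h t ^ θ ≤ w t ^ q := by rw [hwq]; exact le_self_add
      have h2 := ENNReal.rpow_le_rpow h1 (by positivity : 0 ≤ p / q)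
      rw [← ENNReal.rpow_mul, ← ENNReal.rpow_mul] at h2
      have e1 : θ * (p / q) = 1 := by rw [hθ]; field_simp
      have e2 : q * (p / q) = p := by field_simp
      rwa [e1, e2, ENNReal.rpow_one] at h2
    obtain ⟨v, hvm, hwv, hvD, hvq⟩ := rdf q hq hwm
    have hv0 : ∀ t, v t ≠ 0 := by
      intro t h0
      have h1 : w t ^ q = 0 := by
        have : w t = 0 := le_antisymm ((hwv t).trans h0.le) zero_le
        rw [this, ENNReal.zero_rpow_of_pos hq0]
      rw [hwq] at h1
      have h2 := (add_eq_zero.1 h1).2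
      have := he0 t
      simp only [ENNReal.coe_eq_zero] at h2
      exact this.ne' h2
    have hvfin : ∫⁻ t, v t ^ q ≠ ∞ := by
      refine ne_top_of_le_ne_top ?_ (hvq.trans (mul_le_mul_right hwW _))
      exact ENNReal.mul_ne_top (ENNReal.mul_ne_top (ENNReal.rpow_ne_top_of_nonneg hq0.le (by simp)) (by simp))
        (ENNReal.add_ne_top.2 ⟨hHt, hεt⟩)
    have hvt : ∀ᵐ t, v t ≠ ∞ := by
      filter_upwards [ae_lt_top (hvm.pow_const q) hvfin] with t ht h1
      rw [h1, ENNReal.top_rpow_of_pos hq0] at ht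
      exact lt_irrefl _ ht
    have hvpm : Measurable fun t => v t ^ (q - p) := hvm.pow_const _
    have hwt : ∫⁻ t, G t * v t ^ (q - p) ≤ A * ∫⁻ t, v t ^ q := by
      have h1 := vv_swap ν (hlM_meas_param g hg) hvpm p
      dsimp only at h1
      calc ∫⁻ t, G t * v t ^ (q - p) = _ := h1
        _ ≤ ∫⁻ x, A * (∫⁻ t, g (t, x) ^ p * v t ^ (q - p)) ∂ν :=
            lintegral_mono fun x => hl_weighted p q hq hqp hvm (hg.comp measurable_prodMk_right) D hvD hv0 hvt
        _ = A * ∫⁻ t, h t * v t ^ (q - p) := by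
            rw [lintegral_const_mul' _ _ hAt, ← vv_swap ν hg hvpm p]
        _ ≤ _ := by
            gcongr 1
            refine lintegral_mono fun t => ?_
            calc h t * v t ^ (q - p) ≤ v t ^ p * v t ^ (q - p) := by
                  gcongr 1
                  exact (hhw t).trans (ENNReal.rpow_le_rpow (hwv t) hp0.le)
              _ ≤ v t ^ (p + (q - p)) := rpow_mul_rpow_neg_le _ _ _ hp0 (by linarith)
              _ = _ := by congr 1; ring
    calc ∫⁻ t, G t ^ θ = ∫⁻ t, (G t * v t ^ (q - p)) ^ θ * (v t ^ q) ^ (1 - θ) := by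
          refine lintegral_congr_ae ?_
          filter_upwards [hvt] with t ht
          rw [ENNReal.mul_rpow_of_nonneg _ _ hθ0.le, ← ENNReal.rpow_mul, ← ENNReal.rpow_mul, mul_assoc,
            ← ENNReal.rpow_add _ _ (hv0 t) ht]
          have : (q - p) * θ + q * (1 - θ) = 0 := by rw [hθ]; field_simp; ring
          rw [this]; simp
      _ ≤ (∫⁻ t, G t * v t ^ (q - p)) ^ θ * (∫⁻ t, v t ^ q) ^ (1 - θ) :=
          ENNReal.lintegral_mul_norm_pow_le (hGm.mul hvpm).aemeasurable (hvm.pow_const q).aemeasurable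
            hθ0.le (by linarith) (by ring)
      _ ≤ (A * ∫⁻ t, v t ^ q) ^ θ * (∫⁻ t, v t ^ q) ^ (1 - θ) := by gcongr
      _ = A ^ θ * ∫⁻ t, v t ^ q := by
          rw [ENNReal.mul_rpow_of_nonneg _ _ hθ0.le, mul_assoc, ← ENNReal.rpow_add_of_nonneg _ _ hθ0.le (by linarith)]
          simp
      _ ≤ A ^ θ * (2 ^ q * 2 * ((∫⁻ t, h t ^ θ) + ε)) := by
          gcongr 1
          exact hvq.trans (mul_le_mul_right hwW _)
      _ = _ := by rw [hC]; ring
  refine ge_of_tendsto (x := nhdsWithin (0 : ℝ≥0∞) (Ioi 0)) (f := fun ε => C * ((∫⁻ t, h t ^ θ) + ε)) ?_ ?_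
  · have : Tendsto (fun ε : ℝ≥0∞ => C * ((∫⁻ t, h t ^ θ) + ε)) (nhds 0) (nhds (C * ((∫⁻ t, h t ^ θ) + 0))) :=
      ENNReal.Tendsto.const_mul (tendsto_const_nhds.add tendsto_id) (Or.inr hCt)
    rw [add_zero] at this
    exact this.mono_left nhdsWithin_le_nhds
  · have h1 : ∀ᶠ ε : ℝ≥0∞ in nhdsWithin 0 (Ioi 0), ε < 1 :=
      nhdsWithin_le_nhds (Iio_mem_nhds zero_lt_one)
    filter_upwards [self_mem_nhdsWithin, h1] with ε hε hε1
    exact key ε (ne_of_gt hε) (hε1.trans ENNReal.one_lt_top).ne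

theorem vv (p q : ℝ) (hp : 1 < p) (hq : 1 < q) :
    ∃ C : ℝ≥0∞, C ≠ ∞ ∧ ∀ g : E × X → ℝ≥0∞, Measurable g →
      ∫⁻ t, (∫⁻ x, hlM (fun s => g (s, x)) t ^ p ∂ν) ^ (q / p) ≤
        C * ∫⁻ t, (∫⁻ x, g (t, x) ^ p ∂ν) ^ (q / p) := by
  rcases lt_trichotomy p q with h | h | h
  · exact vv_gt ν p q hp h
  · subst h
    refine ⟨hlK E p, hlK_ne_top p hp, fun g hg => ?_⟩
    have := vv_base ν p hp hg (φ := fun _ : E => 1) measurable_const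
    simp only [mul_one] at this
    rw [div_self (by linarith)]
    simp only [ENNReal.rpow_one]
    refine this.trans ?_
    gcongr with t
    exact mul_le_of_le_one_right' (hlM_const_le 1 t)
  · exact vv_lt ν p q hq h

end VV

theorem hl_exists (y : E) (r : ℝ) (hr : 0 < r) :
    ∃ i : ℕ × ℚ, Metric.ball y r ⊆ hlB E i ∧
      volume (hlB E i) ≤ ENNReal.ofReal (3 ^ Module.finrank ℝ E) * volume (Metric.ball y r) := by
  obtain ⟨n, hn⟩ := (TopologicalSpace.denseRange_denseSeq E).exists_dist_lt y hr
  obtain ⟨s, hs1, hs2⟩ := exists_rat_btwn (show 2 * r < 3 * r by linarith)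
  refine ⟨(n, s), ?_, ?_⟩
  · unfold hlB
    refine Metric.ball_subset_ball' ?_
    dsimp only
    linarith
  · have : volume (hlB E (n, s)) ≤ volume (Metric.ball (TopologicalSpace.denseSeq E n) (3 * r)) :=
      measure_mono (Metric.ball_subset_ball hs2.le)
    refine this.trans ?_
    rw [Measure.addHaar_ball _ _ (by positivity), Measure.addHaar_ball _ _ hr.le, mul_pow,
        ENNReal.ofReal_mul (by positivity), mul_assoc]

theorem hlM_meas_param' {X : Type*} [MeasurableSpace X] (g : X × E → ℝ≥0∞)
    (hg : Measurable g) : Measurable (fun z : X × E => hlM (fun s => g (z.1, s)) z.2) := by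
  have h1 : Measurable (fun z : E × X => g (z.2, z.1)) := hg.comp measurable_swap
  have h2 := hlM_meas_param _ h1
  have h3 : Measurable (fun z : X × E => (z.2, z.1)) := measurable_swap
  exact h2.comp h3

end HL

theorem pCyl_eq (d : ℕ) (r : ℝ) (w : Pt d) :
    pCyl d r w = Ico w.1 (w.1 + r ^ 2) ×ˢ Metric.ball w.2 r := by
  ext z
  simp only [pCyl, mem_ofPred_eq, mem_prod, mem_Ico, Metric.mem_ball, dist_comm w.2 z.2]
  tauto

theorem pMax_le (d : ℕ) (hd : 1 ≤ d) :
    ∃ K : ℝ≥0∞, K ≠ ∞ ∧ ∀ f : Pt d → ℝ≥0∞, Measurable f → ∀ t x,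
      pMax d f (t, x) ≤ K * hlM (fun s : ℝ => hlM (fun y : Ed d => f (s, y)) x) t := by
  have : Nonempty (Fin d) := ⟨⟨0, hd⟩⟩
  set K1 : ℝ≥0∞ := ENNReal.ofReal (3 ^ Module.finrank ℝ ℝ) with hK1
  set K2 : ℝ≥0∞ := ENNReal.ofReal (3 ^ Module.finrank ℝ (Ed d)) with hK2
  refine ⟨K1 * 2 * K2, ENNReal.mul_ne_top (ENNReal.mul_ne_top ENNReal.ofReal_ne_top (by simp))
    ENNReal.ofReal_ne_top, fun f hf t x => ?_⟩
  unfold pMax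
  refine iSup_le fun r => iSup_le fun hr => iSup_le fun w => iSup_le fun hw => ?_
  unfold pAvg
  rw [pCyl_eq] at hw ⊢
  obtain ⟨hwt, hwx⟩ := hw
  dsimp only at hwt hwx
  have hr2 : 0 < r ^ 2 := by positivity
  obtain ⟨i, hi, hiv⟩ := hl_exists w.1 (r ^ 2) hr2
  obtain ⟨j, hj, hjv⟩ := hl_exists w.2 r hr
  have hsub : Ico w.1 (w.1 + r ^ 2) ⊆ hlB ℝ i := by
    refine Subset.trans ?_ hi
    intro s hs
    rw [Metric.mem_ball, Real.dist_eq, abs_lt]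
    constructor <;> linarith [hs.1, hs.2]
  have hVt : volume (hlB ℝ i) ≤ K1 * 2 * volume (Ico w.1 (w.1 + r ^ 2)) := by
    refine hiv.trans ?_
    rw [Real.volume_ball, Real.volume_Ico, ENNReal.ofReal_mul (by norm_num), mul_assoc]
    simp [hK1]
  set MM := hlM (fun s : ℝ => hlM (fun y : Ed d => f (s, y)) x) t with hMM
  set V := volume (Ico w.1 (w.1 + r ^ 2)) * volume (Metric.ball w.2 r) with hV
  have hVeq : volume (Ico w.1 (w.1 + r ^ 2) ×ˢ Metric.ball w.2 r) = V := by
    rw [Measure.volume_eq_prod, Measure.prod_prod]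
  have hV0 : V ≠ 0 := by
    refine mul_ne_zero ?_ (Metric.measure_ball_pos _ _ hr).ne'
    rw [Real.volume_Ico]
    simpa using hr.ne'
  have hVtop : V ≠ ∞ := ENNReal.mul_ne_top (by rw [Real.volume_Ico]; exact ENNReal.ofReal_ne_top)
    Metric.isBounded_ball.measure_lt_top.ne
  have hint : ∫⁻ z in Ico w.1 (w.1 + r ^ 2) ×ˢ Metric.ball w.2 r, f z ≤ K1 * 2 * K2 * V * MM := by
    rw [Measure.volume_eq_prod, ← Measure.prod_restrict, lintegral_prod _ hf.aemeasurable]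
    calc ∫⁻ s in Ico w.1 (w.1 + r ^ 2), ∫⁻ y in Metric.ball w.2 r, f (s, y)
        ≤ ∫⁻ s in hlB ℝ i, ∫⁻ y in hlB (Ed d) j, f (s, y) := by
          refine (lintegral_mono_set hsub).trans ?_
          exact lintegral_mono fun s => lintegral_mono_set hj
      _ ≤ ∫⁻ s in hlB ℝ i, volume (hlB (Ed d) j) * hlM (fun y : Ed d => f (s, y)) x :=
          lintegral_mono fun s => hl_lint_le _ j (hj hwx)
      _ = volume (hlB (Ed d) j) * ∫⁻ s in hlB ℝ i, hlM (fun y : Ed d => f (s, y)) x := by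
          rw [lintegral_const_mul' _ _ (hlB_pos (hj hwx)).2]
      _ ≤ volume (hlB (Ed d) j) * (volume (hlB ℝ i) * MM) := by
          gcongr 1
          exact hl_lint_le _ i (hsub hwt)
      _ ≤ (K2 * volume (Metric.ball w.2 r)) * ((K1 * 2 * volume (Ico w.1 (w.1 + r ^ 2))) * MM) := by
          gcongr
      _ = _ := by rw [hV]; ring
  rw [hVeq]
  calc V⁻¹ * ∫⁻ z in Ico w.1 (w.1 + r ^ 2) ×ˢ Metric.ball w.2 r, f z
      ≤ V⁻¹ * (K1 * 2 * K2 * V * MM) := by gcongr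
    _ = (V⁻¹ * V) * (K1 * 2 * K2 * MM) := by ring
    _ = _ := by rw [ENNReal.inv_mul_cancel hV0 hVtop, one_mul]


theorem F_meas (d : ℕ) [Nontrivial (Ed d)] (f : Pt d → ℝ≥0∞) (hf : Measurable f) :
    Measurable (fun z : ℝ × Ed d => hlM (fun y : Ed d => f (z.1, y)) z.2) :=
  hlM_meas_param' f hf

/-- Lemma 5.1, (5.2): for `p, q ∈ (1,∞)` there is `N = N(d,p,q)` with
`∫_ℝ (∫_{ℝ^d} (M̂ f)^p dx)^{q/p} dt ≤ N ∫_ℝ (∫_{ℝ^d} f^p dx)^{q/p} dt`. -/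
theorem stmt15 (d : ℕ) (hd : 1 ≤ d) (p q : ℝ) (hp : 1 < p) (hq : 1 < q) :
    ∃ N : ℝ, 0 < N ∧ ∀ f : Pt d → ℝ≥0∞, Measurable f →
      ∫⁻ t : ℝ, (∫⁻ x : Ed d, pMax d f (t, x) ^ p) ^ (q / p) ≤
        ENNReal.ofReal N * ∫⁻ t : ℝ, (∫⁻ x : Ed d, f (t, x) ^ p) ^ (q / p) := by
  have : Nonempty (Fin d) := ⟨⟨0, hd⟩⟩
  have hp0 : 0 < p := by linarith
  have hq0 : 0 < q := by linarith
  obtain ⟨K, hKt, hK⟩ := pMax_le d hd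
  obtain ⟨C, hCt, hC⟩ := vv (E := ℝ) (volume : Measure (Ed d)) p q hp hq
  obtain ⟨L, hLt, hL⟩ : ∃ L : ℝ≥0∞, L ≠ ∞ ∧ ∀ g : Ed d → ℝ≥0∞, Measurable g →
      ∫⁻ x, hlM g x ^ p ≤ L * ∫⁻ x, g x ^ p :=
    ⟨hlK (Ed d) p, hlK_ne_top p hp, fun g hg => hl_strong1 p hp hg⟩
  obtain ⟨T, hT⟩ : ∃ T : ℝ≥0∞, T = (K ^ p) ^ (q / p) * (C * L ^ (q / p)) := ⟨_, rfl⟩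
  have hr0 : 0 ≤ q / p := by positivity
  have hKp : (K ^ p) ≠ ∞ := ENNReal.rpow_ne_top_of_nonneg hp0.le hKt
  have hKpq : (K ^ p) ^ (q / p) ≠ ∞ := ENNReal.rpow_ne_top_of_nonneg hr0 hKp
  have hLq : L ^ (q / p) ≠ ∞ := ENNReal.rpow_ne_top_of_nonneg hr0 hLt
  have hTt : T ≠ ∞ := by
    rw [hT]; exact ENNReal.mul_ne_top hKpq (ENNReal.mul_ne_top hCt hLq)
  refine ⟨T.toReal + 1, by positivity, fun f hf => ?_⟩
  have hTN : T ≤ ENNReal.ofReal (T.toReal + 1) := by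
    exact ENNReal.le_ofReal_iff_toReal_le hTt (by positivity) |>.2 (by linarith)
  obtain ⟨F, hFm, hF⟩ : ∃ F : ℝ × Ed d → ℝ≥0∞, Measurable F ∧
      ∀ t x, F (t, x) = hlM (fun y : Ed d => f (t, y)) x :=
    ⟨fun z => hlM (fun y : Ed d => f (z.1, y)) z.2,
      F_meas d f hf,
      fun t x => rfl⟩
  have hK' : ∀ t x, pMax d f (t, x) ≤ K * hlM (fun s => F (s, x)) t := by
    intro t x
    simp only [hF]
    exact hK f hf t x
  have hL' : ∀ t, ∫⁻ x : Ed d, F (t, x) ^ p ≤ L * ∫⁻ x : Ed d, f (t, x) ^ p := by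
    intro t
    simp only [hF]
    exact hL (fun y => f (t, y)) (hf.comp measurable_prodMk_left)
  calc ∫⁻ t : ℝ, (∫⁻ x : Ed d, pMax d f (t, x) ^ p) ^ (q / p)
      ≤ ∫⁻ t : ℝ, (K ^ p) ^ (q / p) * (∫⁻ x : Ed d, hlM (fun s => F (s, x)) t ^ p) ^ (q / p) := by
        refine lintegral_mono fun t => ?_
        dsimp only
        rw [← ENNReal.mul_rpow_of_nonneg _ _ hr0]
        refine ENNReal.rpow_le_rpow ?_ hr0
        rw [← lintegral_const_mul' _ _ hKp]
        refine lintegral_mono fun x => ?_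
        dsimp only
        rw [← ENNReal.mul_rpow_of_nonneg _ _ hp0.le]
        exact ENNReal.rpow_le_rpow (hK' t x) hp0.le
    _ = (K ^ p) ^ (q / p) * ∫⁻ t : ℝ, (∫⁻ x : Ed d, hlM (fun s => F (s, x)) t ^ p) ^ (q / p) :=
        lintegral_const_mul' _ _ hKpq
    _ ≤ (K ^ p) ^ (q / p) * (C * ∫⁻ t : ℝ, (∫⁻ x : Ed d, F (t, x) ^ p) ^ (q / p)) := by
        gcongr 1
        exact hC F hFm
    _ ≤ (K ^ p) ^ (q / p) * (C * ∫⁻ t : ℝ, L ^ (q / p) * (∫⁻ x : Ed d, f (t, x) ^ p) ^ (q / p)) := by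
        gcongr with t
        rw [← ENNReal.mul_rpow_of_nonneg _ _ hr0]
        refine ENNReal.rpow_le_rpow ?_ hr0
        exact hL' t
    _ = T * ∫⁻ t : ℝ, (∫⁻ x : Ed d, f (t, x) ^ p) ^ (q / p) := by
        rw [lintegral_const_mul' _ _ hLq, hT]; ring
    _ ≤ _ := by gcongr
end
end
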